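/- arXiv:2206.11430 — 9 statements merged into one kernel-verified Lean document; each statement's English description precedes it below -/
import Mathlib

section
/- For all real numbers λ with 0 ≤ λ < 1, ε with 0 ≤ ε ≤ 1, and d ≥ 0, one has Σ_{i=1}^∞ d·λ^{i-1}·(1 − (1−ε)^i) ≤ ε·d/(1−λ)². -/
/-- Closed form of a geometric series weighted by the probabilities `1 - q ^ (n + 1)`. -/
theorem hasSum_pow_mul_one_sub_pow_succ {r q : ℝ} (hr0 : 0 ≤ r) (hr1 : r < 1)
    (hq0 : 0 ≤ q) (hq1 : q ≤ 1) (d : ℝ) :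
    HasSum (fun n : ℕ => d * r ^ n * (1 - q ^ (n + 1)))
      ((1 - q) * d / ((1 - r) * (1 - r * q))) := by
  have hrq : r * q < 1 := (mul_le_of_le_one_right hr0 hq1).trans_lt hr1
  have hr : 1 - r ≠ 0 := (sub_pos.2 hr1).ne'
  have hrq' : 1 - r * q ≠ 0 := (sub_pos.2 hrq).ne'
  have h := ((hasSum_geometric_of_lt_one hr0 hr1).mul_left d).sub
    ((hasSum_geometric_of_lt_one (mul_nonneg hr0 hq0) hrq).mul_left (d * q))
  have hval : d * (1 - r)⁻¹ - d * q * (1 - r * q)⁻¹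
      = (1 - q) * d / ((1 - r) * (1 - r * q)) := by
    field_simp
    ring
  rw [← hval]
  refine (congrArg (HasSum · _) (funext fun n => ?_)).mpr h
  rw [mul_pow]
  ring

/-- For all real `λ` with `0 ≤ λ < 1`, `ε` with `0 ≤ ε ≤ 1`, and `d ≥ 0`,
the series `Σ_{i=1}^∞ d·λ^{i-1}·(1 − (1−ε)^i)` converges and is at most `ε·d/(1−λ)²`.
(The index `i ≥ 1` is represented by `i = n + 1` for `n : ℕ`.) -/
theorem stmt1 (lam eps d : ℝ) (hlam0 : 0 ≤ lam) (hlam1 : lam < 1)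
    (heps0 : 0 ≤ eps) (heps1 : eps ≤ 1) (hd : 0 ≤ d) :
    Summable (fun n : ℕ => d * lam ^ n * (1 - (1 - eps) ^ (n + 1))) ∧
    ∑' n : ℕ, d * lam ^ n * (1 - (1 - eps) ^ (n + 1)) ≤ eps * d / (1 - lam) ^ 2 := by
  have h := hasSum_pow_mul_one_sub_pow_succ hlam0 hlam1 (sub_nonneg.2 heps1)
    (sub_le_self 1 heps0) d
  refine ⟨h.summable, h.tsum_eq.trans_le ?_⟩
  have hpos : 0 < 1 - lam := sub_pos.2 hlam1
  have hle : lam * (1 - eps) ≤ lam := mul_le_of_le_one_right hlam0 (sub_le_self 1 heps0)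
  rw [sub_sub_cancel, sq]
  gcongr
end

section
/- Let n be a finite index type, A : Matrix n n ℝ a nonnegative matrix with K-bounded potential, and b : n → ℝ with |b j| ≤ c for all j, where c ≥ 0. Then the series Σ_{i=0}^∞ A^i *ᵥ b converges absolutely (each coordinate of Σ_i |A^i *ᵥ b| is finite), and its sum s satisfies |s j| ≤ K·c for every coordinate j. -/
open Matrix

/-- The powers of an entrywise nonnegative matrix are entrywise nonnegative. -/
theorem Matrix.pow_apply_nonneg_of_nonneg {n : Type*} [Fintype n] [DecidableEq n]
    {A : Matrix n n ℝ} (hA : ∀ i j, 0 ≤ A i j) (k : ℕ) (i j : n) : 0 ≤ (A ^ k) i j := by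
  induction k generalizing i j with
  | zero =>
    rw [pow_zero, Matrix.one_apply]
    split_ifs <;> norm_num
  | succ k ih =>
    rw [pow_succ, Matrix.mul_apply]
    exact Finset.sum_nonneg fun l _ => mul_nonneg (ih i l) (hA l j)

/-- A nonnegative matrix maps a vector bounded by `c` to one bounded by `c` times the row sums. -/
theorem Matrix.abs_mulVec_le_mulVec_one_mul {m n : Type*} [Fintype n]
    {B : Matrix m n ℝ} (hB : ∀ i j, 0 ≤ B i j) {b : n → ℝ} {c : ℝ} (hb : ∀ j, |b j| ≤ c) (i : m) :
    |(B *ᵥ b) i| ≤ (B *ᵥ fun _ => (1 : ℝ)) i * c := by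
  simp only [Matrix.mulVec, dotProduct, mul_one, Finset.sum_mul]
  refine (Finset.abs_sum_le_sum_abs _ _).trans (Finset.sum_le_sum fun j _ => ?_)
  rw [abs_mul, abs_of_nonneg (hB i j)]
  exact mul_le_mul_of_nonneg_left (hb j) (hB i j)

/-- A real series whose absolute partial sums are bounded by `C` is absolutely summable, with sum
at most `C` in absolute value. -/
theorem summable_abs_and_abs_tsum_le_of_sum_range_le {f : ℕ → ℝ} {C : ℝ}
    (h : ∀ N, ∑ i ∈ Finset.range N, |f i| ≤ C) :
    Summable (fun i => |f i|) ∧ |∑' i, f i| ≤ C := by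
  have hf : Summable fun i => ‖f i‖ := summable_of_sum_range_le (fun _ => abs_nonneg _) h
  exact ⟨hf, (norm_tsum_le_tsum_norm hf).trans
    (Real.tsum_le_of_sum_range_le (fun _ => abs_nonneg _) h)⟩

/-- if `A` is nonnegative with `K`-bounded potential and `|b j| ≤ c` for all `j`
with `c ≥ 0`, then `Σ_{i=0}^∞ A^i *ᵥ b` converges absolutely in every coordinate and its sum
satisfies `|s j| ≤ K·c` for every coordinate `j`. -/
theorem stmt4 {n : Type*} [Fintype n] [DecidableEq n]
    (A : Matrix n n ℝ) (hA : ∀ i j, 0 ≤ A i j)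
    (K : ℝ)
    (hK : ∀ (k : ℕ) (j : n),
      ((∑ i ∈ Finset.range (k + 1), A ^ i) *ᵥ (fun _ => (1 : ℝ))) j ≤ K)
    (b : n → ℝ) (c : ℝ) (hc : 0 ≤ c) (hb : ∀ j, |b j| ≤ c) :
    (∀ j, Summable (fun i : ℕ => |((A ^ i) *ᵥ b) j|)) ∧
    (∀ j, |∑' i : ℕ, ((A ^ i) *ᵥ b) j| ≤ K * c) := by
  have hbound (j : n) (N : ℕ) : ∑ i ∈ Finset.range N, |((A ^ i) *ᵥ b) j| ≤ K * c :=
    calc ∑ i ∈ Finset.range N, |((A ^ i) *ᵥ b) j|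
        ≤ ∑ i ∈ Finset.range (N + 1), |((A ^ i) *ᵥ b) j| := by
          rw [Finset.sum_range_succ]
          exact le_add_of_nonneg_right (abs_nonneg _)
      _ ≤ ∑ i ∈ Finset.range (N + 1), ((A ^ i) *ᵥ fun _ => (1 : ℝ)) j * c :=
          Finset.sum_le_sum fun i _ => Matrix.abs_mulVec_le_mulVec_one_mul
            (Matrix.pow_apply_nonneg_of_nonneg hA i) hb j
      _ = ((∑ i ∈ Finset.range (N + 1), A ^ i) *ᵥ fun _ => (1 : ℝ)) j * c := by
          rw [Matrix.sum_mulVec, Finset.sum_apply, Finset.sum_mul]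
      _ ≤ K * c := mul_le_mul_of_nonneg_right (hK N j) hc
  exact ⟨fun j => (summable_abs_and_abs_tsum_le_of_sum_range_le (hbound j)).1,
    fun j => (summable_abs_and_abs_tsum_le_of_sum_range_le (hbound j)).2⟩
end

section
/- Let n be a finite index type, A : Matrix n n ℝ a nonnegative matrix with K-bounded potential, and b : n → ℝ a bounded vector. Define F(x) = A *ᵥ x + b. Then for every starting vector x : n → ℝ, the iterates F^[k](x) converge coordinatewise to Σ_{i=0}^∞ A^i *ᵥ b as k → ∞; in particular the limit is independent of x. -/
open Matrix Filter

theorem Matrix.abs_mulVec_le {n : Type*} [Fintype n]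
    {B : Matrix n n ℝ} (hB : ∀ i j, 0 ≤ B i j) (v : n → ℝ) (j : n) :
    |(B *ᵥ v) j| ≤ ‖v‖ * (B *ᵥ fun _ => (1 : ℝ)) j := by
  simp only [Matrix.mulVec, dotProduct, mul_one, Finset.mul_sum]
  refine (Finset.abs_sum_le_sum_abs _ _).trans (Finset.sum_le_sum fun l _ => ?_)
  rw [abs_mul, abs_of_nonneg (hB j l), mul_comm]
  exact mul_le_mul_of_nonneg_right (norm_le_pi_norm v l) (hB j l)

theorem Matrix.summable_pow_mulVec {n : Type*} [Fintype n] [DecidableEq n]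
    {A : Matrix n n ℝ} (hA : ∀ i j, 0 ≤ A i j) {K : ℝ}
    (hK : ∀ (k : ℕ) (j : n),
      ((∑ i ∈ Finset.range (k + 1), A ^ i) *ᵥ (fun _ => (1 : ℝ))) j ≤ K)
    (v : n → ℝ) (j : n) : Summable fun i : ℕ => ((A ^ i) *ᵥ v) j := by
  have nonneg : ∀ i, 0 ≤ ((A ^ i) *ᵥ fun _ => (1 : ℝ)) j := fun i =>
    Finset.sum_nonneg fun l _ => mul_nonneg (Matrix.pow_apply_nonneg hA i j l) zero_le_one
  have summable_one : Summable fun i : ℕ => ((A ^ i) *ᵥ fun _ => (1 : ℝ)) j := by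
    refine summable_of_sum_range_le (c := K) nonneg fun k => ?_
    have h := hK k j
    rw [Matrix.sum_mulVec, Finset.sum_apply, Finset.sum_range_succ] at h
    linarith [nonneg k]
  exact (summable_one.mul_left ‖v‖).of_norm_bounded fun i =>
    Matrix.abs_mulVec_le (Matrix.pow_apply_nonneg hA i) v j

theorem Matrix.iterate_mulVec_add {n : Type*} [Fintype n] [DecidableEq n]
    {A : Matrix n n ℝ} {b : n → ℝ} {F : (n → ℝ) → (n → ℝ)} (hF : ∀ x, F x = A *ᵥ x + b)
    (x : n → ℝ) (k : ℕ) :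
    F^[k] x = (A ^ k) *ᵥ x + ∑ i ∈ Finset.range k, (A ^ i) *ᵥ b := by
  induction k with
  | zero => simp
  | succ k ih =>
    rw [Function.iterate_succ_apply', hF, ih, Matrix.mulVec_add, Matrix.mulVec_mulVec,
      ← pow_succ', Finset.sum_range_succ', Matrix.mulVec_sum, pow_zero, Matrix.one_mulVec,
      add_assoc]
    simp only [Matrix.mulVec_mulVec, ← pow_succ']

/-- if `A` is nonnegative with `K`-bounded potential and `b` is bounded, then for
`F x = A *ᵥ x + b` the iterates `F^[k] x` converge coordinatewise to `Σ_{i=0}^∞ A^i *ᵥ b`,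
for every starting vector `x`. -/
theorem stmt5 {n : Type*} [Fintype n] [DecidableEq n]
    (A : Matrix n n ℝ) (hA : ∀ i j, 0 ≤ A i j)
    (K : ℝ)
    (hK : ∀ (k : ℕ) (j : n),
      ((∑ i ∈ Finset.range (k + 1), A ^ i) *ᵥ (fun _ => (1 : ℝ))) j ≤ K)
    (b : n → ℝ) (c : ℝ) (hb : ∀ j, |b j| ≤ c)
    (F : (n → ℝ) → (n → ℝ)) (hF : ∀ x, F x = A *ᵥ x + b) :
    ∀ (x : n → ℝ) (j : n),
      Tendsto (fun k : ℕ => F^[k] x j) atTop (nhds (∑' i : ℕ, ((A ^ i) *ᵥ b) j)) := by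
  intro x j
  have tail := (Matrix.summable_pow_mulVec hA hK x j).tendsto_atTop_zero
  have series := (Matrix.summable_pow_mulVec hA hK b j).hasSum.tendsto_sum_nat
  simpa [Matrix.iterate_mulVec_add hF, Finset.sum_apply] using tail.add series
end

section
/- Let n be a finite index type, A : Matrix n n ℝ a nonnegative matrix with K-bounded potential, and b : n → ℝ with |b j| ≤ c for all j. Then x = Σ_{i=0}^∞ A^i *ᵥ b is the unique solution of the linear fixed-point equation x = A *ᵥ x + b in n → ℝ. -/
open Matrix

namespace Matrix

variable {n : Type*} [Fintype n] [DecidableEq n] {A : Matrix n n ℝ}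

theorem pow_apply_nonneg_of_nonneg_s6 (hA : ∀ i j, 0 ≤ A i j) (m : ℕ) (i j : n) :
    0 ≤ (A ^ m) i j := by
  induction m generalizing i j with
  | zero =>
    rw [pow_zero, one_apply]
    split_ifs <;> norm_num
  | succ m ih =>
    rw [pow_succ, mul_apply]
    exact Finset.sum_nonneg fun k _ => mul_nonneg (ih i k) (hA k j)

/-- The entries of the powers of a nonnegative matrix with bounded potential are summable. -/
theorem summable_pow_apply_of_bounded_potential (hA : ∀ i j, 0 ≤ A i j) {K : ℝ}
    (hK : ∀ (k : ℕ) (j : n),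
      ((∑ i ∈ Finset.range (k + 1), A ^ i) *ᵥ (fun _ => (1 : ℝ))) j ≤ K) (j l : n) :
    Summable fun i : ℕ => (A ^ i) j l := by
  refine summable_of_sum_range_le (c := K)
    (fun i => pow_apply_nonneg_of_nonneg_s6 hA i j l) fun m => ?_
  calc ∑ i ∈ Finset.range m, (A ^ i) j l
      ≤ ∑ i ∈ Finset.range (m + 1), (A ^ i) j l := by
        rw [Finset.sum_range_succ]
        exact le_add_of_nonneg_right (pow_apply_nonneg_of_nonneg_s6 hA m j l)
    _ ≤ ∑ l', ∑ i ∈ Finset.range (m + 1), (A ^ i) j l' :=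
        Finset.single_le_sum (f := fun l' => ∑ i ∈ Finset.range (m + 1), (A ^ i) j l')
          (fun l' _ => Finset.sum_nonneg fun i _ => pow_apply_nonneg_of_nonneg_s6 hA i j l')
          (Finset.mem_univ l)
    _ ≤ K := by simpa [mulVec, dotProduct, Matrix.sum_apply] using hK m j

theorem summable_pow_mulVec_apply (hs : ∀ j l, Summable fun i : ℕ => (A ^ i) j l)
    (v : n → ℝ) (j : n) : Summable fun i : ℕ => ((A ^ i) *ᵥ v) j :=
  summable_sum fun l _ => (hs j l).mul_right (v l)

theorem eq_pow_mulVec_add_sum_of_eq_mulVec_add {x b : n → ℝ} (hx : x = A *ᵥ x + b) (m : ℕ) :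
    x = (A ^ m) *ᵥ x + ∑ i ∈ Finset.range m, (A ^ i) *ᵥ b := by
  induction m with
  | zero => simp
  | succ m ih =>
    have h : (A ^ m) *ᵥ x = (A ^ (m + 1)) *ᵥ x + (A ^ m) *ᵥ b := by
      conv_lhs => rw [hx]
      rw [mulVec_add, mulVec_mulVec, pow_succ]
    rw [h] at ih
    rw [Finset.sum_range_succ, add_comm (∑ i ∈ Finset.range m, _), ← add_assoc]
    exact ih

end Matrix

/-- if `A` is nonnegative with `K`-bounded potential and `|b j| ≤ c` for all `j`,
then `x = Σ_{i=0}^∞ A^i *ᵥ b` is the unique solution of `x = A *ᵥ x + b`. -/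
theorem stmt6 {n : Type*} [Fintype n] [DecidableEq n]
    (A : Matrix n n ℝ) (hA : ∀ i j, 0 ≤ A i j)
    (K : ℝ)
    (hK : ∀ (k : ℕ) (j : n),
      ((∑ i ∈ Finset.range (k + 1), A ^ i) *ᵥ (fun _ => (1 : ℝ))) j ≤ K)
    (b : n → ℝ) (c : ℝ) (hb : ∀ j, |b j| ≤ c) :
    (fun j => ∑' i : ℕ, ((A ^ i) *ᵥ b) j) =
        A *ᵥ (fun j => ∑' i : ℕ, ((A ^ i) *ᵥ b) j) + b ∧
    ∀ x : n → ℝ, x = A *ᵥ x + b → x = fun j => ∑' i : ℕ, ((A ^ i) *ᵥ b) j := by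
  have hs := summable_pow_apply_of_bounded_potential hA hK
  refine ⟨?_, fun x hx => ?_⟩
  · funext j
    rw [(summable_pow_mulVec_apply hs b j).tsum_eq_zero_add, Pi.add_apply, add_comm]
    congr 1
    · simp only [pow_succ', ← mulVec_mulVec]
      exact (hasSum_sum fun l _ =>
        (summable_pow_mulVec_apply hs b l).hasSum.mul_left (A j l)).tsum_eq
    · simp
  · funext j
    have hlim : Filter.Tendsto
        (fun m : ℕ => ((A ^ m) *ᵥ x) j + ∑ i ∈ Finset.range m, ((A ^ i) *ᵥ b) j)
        Filter.atTop (nhds (0 + ∑' i : ℕ, ((A ^ i) *ᵥ b) j)) :=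
      (summable_pow_mulVec_apply hs x j).tendsto_atTop_zero.add
        (summable_pow_mulVec_apply hs b j).hasSum.tendsto_sum_nat
    rw [zero_add] at hlim
    refine tendsto_nhds_unique (tendsto_const_nhds.congr fun m => ?_) hlim
    simpa using congrFun (eq_pow_mulVec_add_sum_of_eq_mulVec_add hx m) j
end

section
/- Let n be a finite index type, A, A' : Matrix n n ℝ, b : n → ℝ, and x : n → ℝ with x = A *ᵥ x + b. Define the sequence x'_0 = x and x'_{k+1} = A' *ᵥ x'_k + b. Then for every k ∈ ℕ, x'_k = x + (Σ_{i=0}^{k-1} (A')^i) *ᵥ ((A' − A) *ᵥ x). -/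
open Matrix

/-- if `x = A *ᵥ x + b` and `x'_0 = x`, `x'_{k+1} = A' *ᵥ x'_k + b`, then for every
`k`, `x'_k = x + (Σ_{i=0}^{k-1} (A')^i) *ᵥ ((A' − A) *ᵥ x)`. -/
theorem stmt7 {n : Type*} [Fintype n] [DecidableEq n]
    (A A' : Matrix n n ℝ) (b x : n → ℝ) (hx : x = A *ᵥ x + b)
    (x' : ℕ → (n → ℝ)) (hx'0 : x' 0 = x)
    (hx'succ : ∀ k : ℕ, x' (k + 1) = A' *ᵥ x' k + b) :
    ∀ k : ℕ,
      x' k = x + (∑ i ∈ Finset.range k, A' ^ i) *ᵥ ((A' - A) *ᵥ x) := by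
  intro k
  induction k with
  | zero => simp [hx'0]
  | succ k ih =>
    have hb : b = x - A *ᵥ x := eq_sub_of_add_eq' hx.symm
    rw [hx'succ, ih, Finset.sum_range_succ', pow_zero]
    simp only [pow_succ', ← Finset.mul_sum]
    rw [mulVec_add, add_mulVec, one_mulVec, mulVec_mulVec, sub_mulVec, hb]
    abel
end

section
/- Let n be a finite index type, A, A' : Matrix n n ℝ with A' nonnegative and having K-bounded potential, and b : n → ℝ. If x = A *ᵥ x + b and x' = A' *ᵥ x' + b, then x' − x = (Σ_{i=0}^∞ (A')^i) *ᵥ ((A' − A) *ᵥ x), where the series converges absolutely. -/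
open Matrix

namespace Matrix

variable {n : Type*} [Fintype n]

theorem mulVec_nonneg_of_nonneg {M : Matrix n n ℝ} (hM : ∀ i j, 0 ≤ M i j) {v : n → ℝ}
    (hv : ∀ j, 0 ≤ v j) (i : n) : 0 ≤ (M *ᵥ v) i :=
  Finset.sum_nonneg fun j _ => mul_nonneg (hM i j) (hv j)

theorem abs_mulVec_le_of_nonneg {M : Matrix n n ℝ} (hM : ∀ i j, 0 ≤ M i j) (v : n → ℝ) (i : n) :
    |(M *ᵥ v) i| ≤ (∑ j, |v j|) * (M *ᵥ fun _ => (1 : ℝ)) i := by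
  simp only [mulVec, dotProduct, mul_one]
  rw [Finset.mul_sum]
  refine (Finset.abs_sum_le_sum_abs _ _).trans (Finset.sum_le_sum fun j _ => ?_)
  rw [abs_mul, abs_of_nonneg (hM i j), mul_comm]
  exact mul_le_mul_of_nonneg_right
    (Finset.single_le_sum (f := fun j => |v j|) (fun _ _ => abs_nonneg _) (Finset.mem_univ j))
    (hM i j)

variable [DecidableEq n]

theorem pow_apply_nonneg_of_nonneg_s8 {M : Matrix n n ℝ} (hM : ∀ i j, 0 ≤ M i j) (k : ℕ) (i j : n) :
    0 ≤ (M ^ k) i j := by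
  induction k generalizing i j with
  | zero =>
    rw [pow_zero, one_apply]
    split_ifs <;> norm_num
  | succ k ih =>
    rw [pow_succ, mul_apply]
    exact Finset.sum_nonneg fun l _ => mul_nonneg (ih i l) (hM l j)

/-- If a nonnegative matrix has bounded potential, its powers applied to any vector are
absolutely summable in every coordinate. -/
theorem summable_abs_pow_mulVec {M : Matrix n n ℝ} (hM : ∀ i j, 0 ≤ M i j) {K : ℝ}
    (hK : ∀ (k : ℕ) (j : n),
      ((∑ i ∈ Finset.range (k + 1), M ^ i) *ᵥ (fun _ => (1 : ℝ))) j ≤ K)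
    (v : n → ℝ) (j : n) : Summable fun i : ℕ => |((M ^ i) *ᵥ v) j| := by
  have hnonneg : ∀ i : ℕ, 0 ≤ ((M ^ i) *ᵥ fun _ => (1 : ℝ)) j := fun i =>
    mulVec_nonneg_of_nonneg (pow_apply_nonneg_of_nonneg_s8 hM i) (fun _ => zero_le_one) j
  have hsum : Summable fun i : ℕ => ((M ^ i) *ᵥ fun _ => (1 : ℝ)) j := by
    refine summable_of_sum_range_le (c := K) hnonneg fun k => ?_
    refine le_trans ?_ (hK k j)
    rw [sum_mulVec, Finset.sum_apply]
    exact Finset.sum_le_sum_of_subset_of_nonneg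
      (Finset.range_subset_range.2 k.le_succ) fun i _ _ => hnonneg i
  exact (hsum.mul_left (∑ l, |v l|)).of_nonneg_of_le (fun _ => abs_nonneg _) fun i =>
    abs_mulVec_le_of_nonneg (pow_apply_nonneg_of_nonneg_s8 hM i) v j

theorem sum_range_pow_mulVec_sub (M : Matrix n n ℝ) (d : n → ℝ) (k : ℕ) :
    ∑ i ∈ Finset.range k, (M ^ i) *ᵥ (d - M *ᵥ d) = d - (M ^ k) *ᵥ d := by
  simp only [mulVec_sub, mulVec_mulVec, ← pow_succ]
  rw [Finset.sum_range_sub' (fun i => (M ^ i) *ᵥ d), pow_zero, one_mulVec]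

end Matrix

/-- if `A'` is nonnegative with `K`-bounded potential, `x = A *ᵥ x + b` and
`x' = A' *ᵥ x' + b`, then `x' − x = (Σ_{i=0}^∞ (A')^i) *ᵥ ((A' − A) *ᵥ x)`, with the series
converging absolutely (coordinatewise). -/
theorem stmt8 {n : Type*} [Fintype n] [DecidableEq n]
    (A A' : Matrix n n ℝ) (hA' : ∀ i j, 0 ≤ A' i j)
    (K : ℝ)
    (hK : ∀ (k : ℕ) (j : n),
      ((∑ i ∈ Finset.range (k + 1), A' ^ i) *ᵥ (fun _ => (1 : ℝ))) j ≤ K)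
    (b x x' : n → ℝ) (hx : x = A *ᵥ x + b) (hx' : x' = A' *ᵥ x' + b) :
    (∀ j, Summable (fun i : ℕ => |((A' ^ i) *ᵥ ((A' - A) *ᵥ x)) j|)) ∧
    (∀ j, x' j - x j = ∑' i : ℕ, ((A' ^ i) *ᵥ ((A' - A) *ᵥ x)) j) := by
  have habs := fun v => summable_abs_pow_mulVec hA' hK v
  refine ⟨habs _, fun j => ?_⟩
  have hdiff : (A' - A) *ᵥ x = (x' - x) - A' *ᵥ (x' - x) := by
    rw [sub_mulVec, mulVec_sub]
    linear_combination hx - hx'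
  refine (((habs _ j).of_abs.hasSum_iff_tendsto_nat).2 ?_).tsum_eq.symm
  have hpartial : ∀ k : ℕ, ∑ i ∈ Finset.range k, ((A' ^ i) *ᵥ ((A' - A) *ᵥ x)) j =
      (x' j - x j) - ((A' ^ k) *ᵥ (x' - x)) j := fun k => by
    rw [hdiff, ← Finset.sum_apply, sum_range_pow_mulVec_sub]
    rfl
  simp only [hpartial]
  simpa using (habs (x' - x) j).of_abs.tendsto_atTop_zero.const_sub (x' j - x j)
end

section
/- Let n be a finite index type, ε ≥ 0, r ≥ 0, K ≥ 0, and let A, A' : Matrix n n ℝ both be nonnegative with K-bounded potential. Assume that for every row j, Σ_l |A'_{j l} − A_{j l}| ≤ 2ε, and let b : n → ℝ with |b j| ≤ r for all j. If x = A *ᵥ x + b and x' = A' *ᵥ x' + b, then ‖x − x'‖∞ ≤ 2·ε·K²·r, where ‖y‖∞ = sup_j |y j|. -/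
open Matrix

theorem Matrix.abs_mulVec_le_of_nonneg_s9 {m n : Type*} [Fintype n] {M : Matrix m n ℝ}
    (hM : ∀ i j, 0 ≤ M i j) {v : n → ℝ} {s : ℝ} (hv : ∀ j, |v j| ≤ s) (i : m) :
    |(M *ᵥ v) i| ≤ s * (M *ᵥ fun _ => (1 : ℝ)) i := by
  simp only [mulVec, dotProduct, mul_one, Finset.mul_sum]
  refine (Finset.abs_sum_le_sum_abs _ _).trans (Finset.sum_le_sum fun j _ => ?_)
  rw [abs_mul, abs_of_nonneg (hM i j), mul_comm]
  exact mul_le_mul_of_nonneg_right (hv j) (hM i j)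

theorem Matrix.eq_pow_mulVec_add_of_eq {n R : Type*} [Fintype n] [DecidableEq n] [CommRing R]
    {A : Matrix n n R} {y c : n → R} (hy : y = A *ᵥ y + c) (k : ℕ) :
    y = A ^ k *ᵥ y + (∑ i ∈ Finset.range k, A ^ i) *ᵥ c := by
  induction k with
  | zero => simp
  | succ k ih =>
    have h : A ^ k *ᵥ y = A ^ (k + 1) *ᵥ y + A ^ k *ᵥ c := by
      conv_lhs => rw [hy]
      rw [mulVec_add, mulVec_mulVec, pow_succ]
    rw [Finset.sum_range_succ, add_mulVec, add_comm (_ *ᵥ c), ← add_assoc, ← h]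
    exact ih

/-- A solution of `y = A *ᵥ y + c`, for a nonnegative matrix `A` with `K`-bounded potential,
is bounded by `K` times any bound on `c`. -/
theorem Matrix.abs_le_of_eq_mulVec_add {n : Type*} [Fintype n] [DecidableEq n]
    {A : Matrix n n ℝ} {K s : ℝ} (hA : ∀ i j, 0 ≤ A i j)
    (hK : ∀ (k : ℕ) (j : n),
      ((∑ i ∈ Finset.range (k + 1), A ^ i) *ᵥ (fun _ => (1 : ℝ))) j ≤ K)
    {y c : n → ℝ} (hy : y = A *ᵥ y + c) (hc : ∀ j, |c j| ≤ s) (j : n) :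
    |y j| ≤ K * s := by
  have hs : 0 ≤ s := (abs_nonneg _).trans (hc j)
  have hpow : ∀ k, 0 ≤ (A ^ k *ᵥ fun _ => (1 : ℝ)) j := fun k =>
    Finset.sum_nonneg fun l _ => mul_nonneg (pow_apply_nonneg hA k j l) zero_le_one
  have hsum : Summable fun k => (A ^ k *ᵥ fun _ => (1 : ℝ)) j := by
    refine summable_of_sum_range_le (c := K) hpow fun k => ?_
    refine le_trans ?_ (hK k j)
    rw [sum_mulVec, Finset.sum_apply]
    exact Finset.sum_le_sum_of_subset_of_nonneg
      (Finset.range_subset_range.2 k.le_succ) fun i _ _ => hpow i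
  have hlim := (((Filter.tendsto_add_atTop_iff_nat 1).2
    hsum.tendsto_atTop_zero).const_mul ‖y‖).add_const (K * s)
  rw [mul_zero, zero_add] at hlim
  refine ge_of_tendsto' hlim fun k => ?_
  have hk := congrFun (eq_pow_mulVec_add_of_eq hy (k + 1)) j
  rw [hk, Pi.add_apply]
  refine (abs_add_le _ _).trans (add_le_add ?_ ?_)
  · exact abs_mulVec_le_of_nonneg_s9 (pow_apply_nonneg hA (k + 1)) (norm_le_pi_norm y) j
  · refine (abs_mulVec_le_of_nonneg_s9 (fun i l => ?_) hc j).trans ?_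
    · rw [sum_apply]
      exact Finset.sum_nonneg fun m _ => pow_apply_nonneg hA m i l
    · rw [mul_comm]
      exact mul_le_mul_of_nonneg_right (hK k j) hs

/-- if `A` and `A'` are nonnegative with `K`-bounded potential, the row sums of
`|A' − A|` are at most `2ε`, `|b j| ≤ r` for all `j`, `x = A *ᵥ x + b` and `x' = A' *ᵥ x' + b`,
then `‖x − x'‖∞ ≤ 2·ε·K²·r`, i.e. `|x j − x' j| ≤ 2·ε·K²·r` for every coordinate `j`. -/
theorem stmt9 {n : Type*} [Fintype n] [DecidableEq n]
    (eps r K : ℝ) (heps : 0 ≤ eps) (hr : 0 ≤ r) (hKnn : 0 ≤ K)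
    (A A' : Matrix n n ℝ)
    (hA : ∀ i j, 0 ≤ A i j) (hA' : ∀ i j, 0 ≤ A' i j)
    (hKA : ∀ (k : ℕ) (j : n),
      ((∑ i ∈ Finset.range (k + 1), A ^ i) *ᵥ (fun _ => (1 : ℝ))) j ≤ K)
    (hKA' : ∀ (k : ℕ) (j : n),
      ((∑ i ∈ Finset.range (k + 1), A' ^ i) *ᵥ (fun _ => (1 : ℝ))) j ≤ K)
    (hrow : ∀ j, ∑ l, |A' j l - A j l| ≤ 2 * eps)
    (b : n → ℝ) (hb : ∀ j, |b j| ≤ r)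
    (x x' : n → ℝ) (hx : x = A *ᵥ x + b) (hx' : x' = A' *ᵥ x' + b) :
    ∀ j, |x j - x' j| ≤ 2 * eps * K ^ 2 * r := by
  have hx'_le : ∀ j, |x' j| ≤ K * r := abs_le_of_eq_mulVec_add hA' hKA' hx' hb
  have hdiff : x - x' = A *ᵥ (x - x') + (A - A') *ᵥ x' := by
    rw [mulVec_sub, sub_mulVec]
    nth_rewrite 1 [hx, hx']
    abel
  have hpert : ∀ j, |((A - A') *ᵥ x') j| ≤ 2 * eps * (K * r) := fun j => by
    calc |((A - A') *ᵥ x') j| ≤ ∑ l, |(A - A') j l * x' l| := Finset.abs_sum_le_sum_abs _ _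
      _ ≤ ∑ l, |A' j l - A j l| * (K * r) := Finset.sum_le_sum fun l _ => by
        rw [abs_mul, Matrix.sub_apply, abs_sub_comm]
        exact mul_le_mul_of_nonneg_left (hx'_le l) (abs_nonneg _)
      _ ≤ 2 * eps * (K * r) := by
        rw [← Finset.sum_mul]
        exact mul_le_mul_of_nonneg_right (hrow j) (mul_nonneg hKnn hr)
  intro j
  refine (abs_le_of_eq_mulVec_add hA hKA hdiff hpert j).trans_eq ?_
  ring
end

section
/- In the Bellman setup with the uniformly-bounded-potential assumption, the Bellman operator F has at most one fixed point: if F(x) = x and F(y) = y then x = y. -/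
open Matrix

/-- A subinvariant vector `d ≤ A d` of a nonnegative matrix with bounded potential is nonpositive. -/
theorem nonpos_of_le_mulVec_of_potential_le {Q : Type*} [Fintype Q] [DecidableEq Q]
    {A : Matrix Q Q ℝ} (hA : ∀ i j, 0 ≤ A i j) {K : ℝ}
    (hK : ∀ (k : ℕ) (j : Q),
      ((∑ i ∈ Finset.range (k + 1), A ^ i) *ᵥ (fun _ => (1 : ℝ))) j ≤ K)
    {d : Q → ℝ} (hd : d ≤ A *ᵥ d) : d ≤ 0 := by
  obtain ⟨M, hM0, hM⟩ : ∃ M : ℝ, 0 ≤ M ∧ ∀ j, d j ≤ M :=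
    ⟨∑ j, |d j|, Finset.sum_nonneg fun j _ => abs_nonneg _, fun j =>
      (le_abs_self _).trans
        (Finset.single_le_sum (f := fun j => |d j|) (fun j _ => abs_nonneg _)
          (Finset.mem_univ j))⟩
  have hmono : ∀ {u v : Q → ℝ}, u ≤ v → A *ᵥ u ≤ A *ᵥ v := fun {u v} huv i =>
    Finset.sum_le_sum fun j _ => mul_le_mul_of_nonneg_left (huv j) (hA i j)
  have hpow : ∀ i : ℕ, d ≤ M • ((A ^ i) *ᵥ (fun _ => (1 : ℝ))) := by
    intro i
    induction i with
    | zero => intro j; simpa using hM j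
    | succ i ih =>
      rw [pow_succ', ← Matrix.mulVec_mulVec, ← Matrix.mulVec_smul]
      exact hd.trans (hmono ih)
  intro j
  have hsum : ∀ k : ℕ, ((k + 1 : ℕ) : ℝ) * d j ≤ M * K := by
    intro k
    calc ((k + 1 : ℕ) : ℝ) * d j = ∑ _i ∈ Finset.range (k + 1), d j := by simp
      _ ≤ ∑ i ∈ Finset.range (k + 1), M * ((A ^ i) *ᵥ (fun _ => (1 : ℝ))) j :=
        Finset.sum_le_sum fun i _ => hpow i j
      _ = M * ((∑ i ∈ Finset.range (k + 1), A ^ i) *ᵥ (fun _ => (1 : ℝ))) j := by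
        rw [Matrix.sum_mulVec, Finset.sum_apply, Finset.mul_sum]
      _ ≤ M * K := mul_le_mul_of_nonneg_left (hK k j) hM0
  by_contra! hpos
  have hpos' : 0 < d j := hpos
  obtain ⟨n, hn⟩ := exists_nat_gt (M * K / d j)
  rw [div_lt_iff₀ hpos'] at hn
  have := hsum n
  push_cast at this
  linarith

/-- Bellman setup: `Q` finite, `act q` a nonempty finite set of actions,
rewards `r q a`, nonnegative weights `w q a`, Bellman operator
`F x q = max_{a ∈ act q} (r q a + Σ_{q'} w q a q' · x q')`, and the uniformly bounded
potential assumption: for every selector `σ` (with induced matrix `A_σ q q' = w q (σ q) q'`)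
and every `k`, `(Σ_{i=0}^k A_σ^i) *ᵥ 1 ≤ K` coordinatewise. Then `F` has at most one
fixed point. -/
theorem stmt10 {Q : Type*} [Fintype Q] [DecidableEq Q] {α : Type*}
    (act : Q → Finset α) (hact : ∀ q, (act q).Nonempty)
    (r : Q → α → ℝ) (w : Q → α → Q → ℝ)
    (hw : ∀ q a, a ∈ act q → ∀ q', 0 ≤ w q a q')
    (K : ℝ)
    (hK : ∀ σ : Q → α, (∀ q, σ q ∈ act q) → ∀ (k : ℕ) (j : Q),
      ((∑ i ∈ Finset.range (k + 1), (Matrix.of fun q q' => w q (σ q) q') ^ i)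
        *ᵥ (fun _ => (1 : ℝ))) j ≤ K)
    (F : (Q → ℝ) → (Q → ℝ))
    (hF : ∀ x q, F x q = (act q).sup' (hact q)
      (fun a => r q a + ∑ q', w q a q' * x q'))
    (x y : Q → ℝ) (hx : F x = x) (hy : F y = y) :
    x = y := by
  have key : ∀ {x y : Q → ℝ}, F x = x → F y = y → x ≤ y := by
    intro x y hx hy
    choose σ hσ hmax using fun q => Finset.exists_mem_eq_sup' (hact q)
      (fun a => r q a + ∑ q', w q a q' * x q')
    rw [← sub_nonpos]
    refine nonpos_of_le_mulVec_of_potential_le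
      (A := Matrix.of fun q q' => w q (σ q) q') (fun q q' => hw q _ (hσ q) q') (hK σ hσ) ?_
    intro q
    have h₁ : x q = r q (σ q) + ∑ q', w q (σ q) q' * x q' := by
      rw [← hmax q, ← hF, hx]
    have h₂ : r q (σ q) + ∑ q', w q (σ q) q' * y q' ≤ y q := by
      conv_rhs => rw [← hy, hF]
      exact Finset.le_sup' (fun a => r q a + ∑ q', w q a q' * y q') (hσ q)
    simp only [Matrix.mulVec, dotProduct, Matrix.of_apply, Pi.sub_apply, mul_sub,
      Finset.sum_sub_distrib]
    linarith
  exact le_antisymm (key hx hy) (key hy hx)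
end

section
/- In the Bellman setup with the uniformly-bounded-potential assumption, if x is a fixed point of the Bellman operator F and σ is a greedy selector for x (i.e., for each q, the action σ(q) attains the maximum in F(x)(q) = max_{a ∈ 𝒜(q)} (r(q,a) + Σ_{q'} w(q,a)(q')·x(q'))), then x = Σ_{i=0}^∞ A_σ^i *ᵥ b_σ; consequently, for every q, x(q) equals the maximum over all selectors τ of (Σ_{i=0}^∞ A_τ^i *ᵥ b_τ)(q), i.e., greedy selectors are optimal stackless strategies. -/
open Matrix

/-- If the partial potentials of a nonnegative matrix are bounded, then its Neumann series applied
to any vector converges coordinatewise. -/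
theorem Matrix.summable_pow_mulVec_of_bounded {Q : Type*} [Fintype Q] [DecidableEq Q]
    {A : Matrix Q Q ℝ} (hA : ∀ i j, 0 ≤ A i j) {K : ℝ}
    (hK : ∀ (k : ℕ) (j : Q),
      ((∑ i ∈ Finset.range (k + 1), A ^ i) *ᵥ (fun _ => (1 : ℝ))) j ≤ K)
    (v : Q → ℝ) (q : Q) : Summable fun i : ℕ => ((A ^ i) *ᵥ v) q := by
  have hone : ∀ i : ℕ, 0 ≤ ((A ^ i) *ᵥ (fun _ => (1 : ℝ))) q := fun i =>
    Finset.sum_nonneg fun k _ => mul_nonneg (pow_apply_nonneg hA i q k) zero_le_one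
  have hsum : Summable fun i : ℕ => ((A ^ i) *ᵥ (fun _ => (1 : ℝ))) q := by
    refine summable_of_sum_range_le (c := K) hone fun n => ?_
    refine le_trans ?_ (hK n q)
    rw [Matrix.sum_mulVec, Finset.sum_apply, Finset.sum_range_succ]
    exact le_add_of_nonneg_right (hone n)
  refine Summable.of_norm_bounded (hsum.mul_left ‖v‖) fun i => ?_
  simp only [Matrix.mulVec, dotProduct, Finset.mul_sum]
  refine (norm_sum_le _ _).trans (Finset.sum_le_sum fun k _ => ?_)
  rw [norm_mul, Real.norm_of_nonneg (pow_apply_nonneg hA i q k), mul_one, mul_comm]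
  exact mul_le_mul_of_nonneg_right (norm_le_pi_norm v k) (pow_apply_nonneg hA i q k)

/-- The Neumann series of a nonnegative matrix with bounded partial potentials inverts
`x ↦ x - A *ᵥ x`. -/
theorem Matrix.hasSum_pow_mulVec_sub {Q : Type*} [Fintype Q] [DecidableEq Q]
    {A : Matrix Q Q ℝ} (hA : ∀ i j, 0 ≤ A i j) {K : ℝ}
    (hK : ∀ (k : ℕ) (j : Q),
      ((∑ i ∈ Finset.range (k + 1), A ^ i) *ᵥ (fun _ => (1 : ℝ))) j ≤ K)
    (x : Q → ℝ) (q : Q) : HasSum (fun i : ℕ => ((A ^ i) *ᵥ (x - A *ᵥ x)) q) (x q) := by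
  rw [(summable_pow_mulVec_of_bounded hA hK _ q).hasSum_iff_tendsto_nat]
  have htelescope : ∀ n : ℕ, ∑ i ∈ Finset.range n, ((A ^ i) *ᵥ (x - A *ᵥ x)) q
      = x q - ((A ^ n) *ᵥ x) q := by
    intro n
    have hterm : ∀ i : ℕ, ((A ^ i) *ᵥ (x - A *ᵥ x)) q
        = ((A ^ i) *ᵥ x) q - ((A ^ (i + 1)) *ᵥ x) q := fun i => by
      rw [Matrix.mulVec_sub, Matrix.mulVec_mulVec, ← pow_succ, Pi.sub_apply]
    simp_rw [hterm]
    rw [Finset.sum_range_sub' (fun i => ((A ^ i) *ᵥ x) q), pow_zero, Matrix.one_mulVec]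
  simp_rw [htelescope]
  simpa using (summable_pow_mulVec_of_bounded hA hK x q).tendsto_atTop_zero.const_sub (x q)

/-- Bellman setup: under the uniformly bounded potential assumption, if `x` is a
fixed point of the Bellman operator `F` and `σ` is a greedy selector for `x`, then
`x = Σ_{i=0}^∞ A_σ^i *ᵥ b_σ`; consequently, for every `q`, `x q` equals the maximum over all
selectors `τ` of the value `(Σ_{i=0}^∞ A_τ^i *ᵥ b_τ) q`, i.e. the value of the greedy selector
attains the maximum and every selector's value is at most `x q`. -/
theorem stmt12 {Q : Type*} [Fintype Q] [DecidableEq Q] {α : Type*}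
    (act : Q → Finset α) (hact : ∀ q, (act q).Nonempty)
    (r : Q → α → ℝ) (w : Q → α → Q → ℝ)
    (hw : ∀ q a, a ∈ act q → ∀ q', 0 ≤ w q a q')
    (K : ℝ)
    (hK : ∀ σ : Q → α, (∀ q, σ q ∈ act q) → ∀ (k : ℕ) (j : Q),
      ((∑ i ∈ Finset.range (k + 1), (Matrix.of fun q q' => w q (σ q) q') ^ i)
        *ᵥ (fun _ => (1 : ℝ))) j ≤ K)
    (F : (Q → ℝ) → (Q → ℝ))
    (hF : ∀ x q, F x q = (act q).sup' (hact q)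
      (fun a => r q a + ∑ q', w q a q' * x q'))
    (x : Q → ℝ) (hx : F x = x)
    (σ : Q → α) (hσ : ∀ q, σ q ∈ act q)
    (hgreedy : ∀ q, r q (σ q) + ∑ q', w q (σ q) q' * x q' = F x q) :
    (∀ q, x q = ∑' i : ℕ,
        (((Matrix.of fun q q' => w q (σ q) q') ^ i) *ᵥ (fun q => r q (σ q))) q) ∧
    (∀ τ : Q → α, (∀ q, τ q ∈ act q) → ∀ q,
        (∑' i : ℕ,
          (((Matrix.of fun q q' => w q (τ q) q') ^ i) *ᵥ (fun q => r q (τ q))) q) ≤ x q) := by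
  have hnonneg : ∀ τ : Q → α, (∀ q, τ q ∈ act q) →
      ∀ i j, 0 ≤ (Matrix.of fun q q' => w q (τ q) q') i j := fun τ hτ i j => hw i (τ i) (hτ i) j
  refine ⟨fun q => ?_, fun τ hτ q => ?_⟩
  · have hb : (fun q => r q (σ q)) = x - (Matrix.of fun q q' => w q (σ q) q') *ᵥ x := by
      funext p
      have h := hgreedy p
      rw [hx] at h
      exact eq_sub_of_add_eq h
    rw [hb]
    exact (Matrix.hasSum_pow_mulVec_sub (hnonneg σ hσ) (hK σ hσ) x q).tsum_eq.symm
  · have hb : ∀ p, r p (τ p) ≤ (x - (Matrix.of fun q q' => w q (τ q) q') *ᵥ x) p := by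
      intro p
      have h : r p (τ p) + ∑ q', w p (τ p) q' * x q' ≤ x p := by
        rw [← congrFun hx p, hF x p]
        exact Finset.le_sup' (fun a => r p a + ∑ q', w p a q' * x q') (hτ p)
      exact le_sub_iff_add_le.mpr h
    refine hasSum_le (fun i => ?_)
      (Matrix.summable_pow_mulVec_of_bounded (hnonneg τ hτ) (hK τ hτ) _ q).hasSum
      (Matrix.hasSum_pow_mulVec_sub (hnonneg τ hτ) (hK τ hτ) x q)
    exact Finset.sum_le_sum fun k _ => mul_le_mul_of_nonneg_left (hb k)
      (Matrix.pow_apply_nonneg (hnonneg τ hτ) i q k)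
end
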